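/- There is an absolute constant C such that for every p with 1 < p < 2 and θ determined by 1/p = θ/2 + (1−θ)/1, every sequence f = (f_k) ∈ L¹(ℓ₁) of functions on 𝕋 satisfies ‖f‖_{L¹/H¹(ℓ_p)} ≤ C·(‖f‖_{L¹/H¹(ℓ₂)})^{θ}·(‖f‖_{L¹/H¹(ℓ₁)})^{1−θ}. -/

import Mathlib

open MeasureTheory Real ENNReal NNReal

noncomputable section

instance : Fact (0 < 2 * Real.pi) := ⟨by positivity⟩

/-- The circle group `𝕋`, realized as `ℝ / 2πℤ`. -/
abbrev 𝕋 : Type := AddCircle (2 * Real.pi)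

/-- The normalized Haar measure on `𝕋`. -/
abbrev μ𝕋 : Measure 𝕋 := AddCircle.haarAddCircle

/-- The mixed norm `‖f‖_{L^p(ℓ_q)} = (∫ (∑_k |f_k|^q)^{p/q} dm)^{1/p}` of a sequence
`f = (f_k)` of functions on `𝕋`, valued in `ℝ≥0∞`. -/
def eLpLqNorm (p q : ℝ) (f : ℕ → 𝕋 → ℂ) : ℝ≥0∞ :=
  (∫⁻ t, ((∑' k, (‖f k t‖₊ : ℝ≥0∞) ^ q) ^ (1 / q)) ^ p ∂μ𝕋) ^ (1 / p)

/-- `f = (f_k)` belongs to `L^p(ℓ_q)`. -/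
def MemLpLq (p q : ℝ) (f : ℕ → 𝕋 → ℂ) : Prop :=
  (∀ k, AEStronglyMeasurable (f k) μ𝕋) ∧ eLpLqNorm p q f < ⊤

/-- `f = (f_k)` belongs to `H^p(ℓ_q)`: it belongs to `L^p(ℓ_q)` and every Fourier
coefficient `f̂_k(n)` with `n < 0` vanishes. -/
def MemHpLq (p q : ℝ) (f : ℕ → 𝕋 → ℂ) : Prop :=
  MemLpLq p q f ∧ ∀ k, ∀ n : ℤ, n < 0 → fourierCoeff (f k) n = 0

/-- The K-functional `K_t(f; X₀, X₁)` for a couple of spaces of sequences of functions given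
by membership predicates `X₀, X₁` and (quasi-)norms `N₀, N₁`:
`inf {N₀(g₀) + t N₁(g₁) : f = g₀ + g₁, g₀ ∈ X₀, g₁ ∈ X₁}`. -/
def Kfunctional (t : ℝ≥0∞) (X₀ X₁ : (ℕ → 𝕋 → ℂ) → Prop)
    (N₀ N₁ : (ℕ → 𝕋 → ℂ) → ℝ≥0∞) (f : ℕ → 𝕋 → ℂ) : ℝ≥0∞ :=
  ⨅ (g₀ : ℕ → 𝕋 → ℂ) (g₁ : ℕ → 𝕋 → ℂ) (_ : X₀ g₀) (_ : X₁ g₁) (_ : f = g₀ + g₁),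
    N₀ g₀ + t * N₁ g₁

/-- A function on `𝕋` belongs to `H¹`: it is integrable and its Fourier coefficients vanish
on the negative integers. -/
def MemH1 (g : 𝕋 → ℂ) : Prop :=
  Integrable g μ𝕋 ∧ ∀ n : ℤ, n < 0 → fourierCoeff g n = 0

/-- The quotient norm `‖f‖_{L¹/H¹(ℓ_q)} = inf {‖f − h‖_{L¹(ℓ_q)} : every h_k ∈ H¹}`. -/
def quotNormLq (q : ℝ) (f : ℕ → 𝕋 → ℂ) : ℝ≥0∞ :=
  ⨅ (h : ℕ → 𝕋 → ℂ) (_ : ∀ k, MemH1 (h k)), eLpLqNorm 1 q (f - h)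

/-- The embedding of `𝕋` into `ℂ` as the unit circle. -/
def circlePt (t : 𝕋) : ℂ := fourier 1 t

lemma continuous_circlePt : Continuous circlePt := (fourier 1).continuous

lemma norm_circlePt (t : 𝕋) : ‖circlePt t‖ = 1 :=
  Circle.norm_coe _

lemma circlePt_mem_closedBall (t : 𝕋) : circlePt t ∈ Metric.closedBall (0 : ℂ) 1 := by
  simp [norm_circlePt]

lemma exists_circlePt_eq {z : ℂ} (hz : ‖z‖ = 1) : ∃ t, circlePt t = z := by
  refine ⟨((Complex.arg z : ℝ) : 𝕋), ?_⟩
  rw [circlePt, fourier_coe_apply]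
  have h := Complex.norm_mul_exp_arg_mul_I z
  rw [hz] at h
  simp only [Complex.ofReal_one, one_mul] at h
  rw [← h]
  congr 1
  have : (π : ℂ) ≠ 0 := by exact_mod_cast Real.pi_ne_zero
  push_cast
  rw [h]
  field_simp

lemma fourier_natCast_eq (n : ℕ) (t : 𝕋) : fourier (n : ℤ) t = circlePt t ^ n := by
  induction n with
  | zero => simp
  | succ n ih => rw [Nat.cast_succ, fourier_add, ih, pow_succ, circlePt]

lemma continuous_comp_circlePt {h : ℂ → ℂ} (hh : ContinuousOn h (Metric.closedBall 0 1)) :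
    Continuous fun t => h (circlePt t) :=
  hh.comp_continuous continuous_circlePt circlePt_mem_closedBall

lemma continuous_boundary {h : ℂ → ℂ} (hh : DiffContOnCl ℂ h (Metric.ball 0 1)) :
    Continuous fun t => h (circlePt t) :=
  continuous_comp_circlePt (by
    simpa [closure_ball (0 : ℂ) one_ne_zero] using hh.continuousOn)

lemma integrable_of_continuous {E : Type*} [NormedAddCommGroup E] {f : 𝕋 → E}
    (hf : Continuous f) : Integrable f μ𝕋 :=
  hf.integrable_of_hasCompactSupport (HasCompactSupport.of_compactSpace f)

/-- The mean value property on the unit circle. -/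
lemma integral_boundary {h : ℂ → ℂ} (hh : DiffContOnCl ℂ h (Metric.ball 0 1)) :
    ∫ t, h (circlePt t) ∂μ𝕋 = h 0 := by
  have h1 := DiffContOnCl.circleAverage (f := h) (c := 0) (R := 1) (by simpa using hh)
  rw [← h1, Real.circleAverage_def, AddCircle.integral_haarAddCircle,
    ← AddCircle.intervalIntegral_preimage (2 * π) 0]
  simp only [zero_add]
  congr 1
  refine intervalIntegral.integral_congr fun x _ => ?_
  simp only [circlePt, fourier_coe_apply, circleMap]
  congr 1
  have : (π : ℂ) ≠ 0 := by exact_mod_cast Real.pi_ne_zero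
  push_cast
  simp only [one_mul, zero_add, mul_one]
  congr 1
  field_simp

lemma memH1_boundary {h : ℂ → ℂ} (hh : DiffContOnCl ℂ h (Metric.ball 0 1)) :
    MemH1 fun t => h (circlePt t) := by
  refine ⟨integrable_of_continuous (continuous_boundary hh), fun n hn => ?_⟩
  obtain ⟨m, hm⟩ : ∃ m : ℕ, -n = m + 1 := ⟨(-n - 1).toNat, by omega⟩
  have hd : DiffContOnCl ℂ (fun z => z ^ (m + 1) • h z) (Metric.ball 0 1) :=
    (Differentiable.diffContOnCl (by fun_prop)).smul hh
  have h2 := integral_boundary hd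
  simp only [ne_eq, Nat.add_eq_zero_iff, one_ne_zero, and_false, not_false_eq_true, zero_pow,
    zero_smul] at h2
  rw [fourierCoeff, ← h2]
  congr 1
  ext t
  rw [hm, ← fourier_natCast_eq, Nat.cast_succ]

/-- Real trigonometric polynomials are real parts of analytic polynomials, and are dense. -/
lemma exists_re_approx {g : 𝕋 → ℝ} (hg : Continuous g) {η : ℝ} (hη : 0 < η) :
    ∃ Φ : ℂ → ℂ, Differentiable ℂ Φ ∧ (Φ 0).im = 0 ∧ ∀ t, |(Φ (circlePt t)).re - g t| < η := by
  let G : C(𝕋, ℂ) := ⟨fun t => (g t : ℂ), by fun_prop⟩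
  have hG : G ∈ (Submodule.span ℂ (Set.range (@fourier (2 * π)))).topologicalClosure := by
    rw [span_fourier_closure_eq_top]; trivial
  obtain ⟨q, hq, hqG⟩ := Metric.mem_closure_iff.1 hG η hη
  have key : ∀ q ∈ Submodule.span ℂ (Set.range (@fourier (2 * π))),
      ∃ Φ : ℂ → ℂ, Differentiable ℂ Φ ∧ (Φ 0).im = 0 ∧
        ∀ t, (Φ (circlePt t)).re = (q t).re := by
    intro q hq
    refine Submodule.closure_induction
      (p := fun q _ => ∃ Φ : ℂ → ℂ, Differentiable ℂ Φ ∧ (Φ 0).im = 0 ∧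
        ∀ t, (Φ (circlePt t)).re = (q t).re) ?_ ?_ ?_ hq
    · exact ⟨fun _ => 0, by fun_prop, by simp, by simp⟩
    · rintro x y _ _ ⟨Φ, h1, h2, h3⟩ ⟨Ψ, h4, h5, h6⟩
      exact ⟨fun z => Φ z + Ψ z, by fun_prop, by simp [h2, h5], fun t => by simp [h3, h6]⟩
    · rintro c _ ⟨n, rfl⟩
      rcases lt_trichotomy n 0 with hn | rfl | hn
      · obtain ⟨m, rfl⟩ : ∃ m : ℕ, n = -((m + 1 : ℕ) : ℤ) := ⟨(-n - 1).toNat, by omega⟩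
        refine ⟨fun z => (starRingEnd ℂ) c * z ^ (m + 1), by fun_prop, by simp, fun t => ?_⟩
        beta_reduce
        rw [← fourier_natCast_eq, ContinuousMap.smul_apply, fourier_neg, ← Complex.conj_re]
        simp
      · exact ⟨fun z => (c.re : ℂ), by fun_prop, by simp, fun t => by simp⟩
      · obtain ⟨m, rfl⟩ : ∃ m : ℕ, n = ((m + 1 : ℕ) : ℤ) := ⟨(n - 1).toNat, by omega⟩
        refine ⟨fun z => c * z ^ (m + 1), by fun_prop, by simp, fun t => ?_⟩
        beta_reduce
        rw [← fourier_natCast_eq]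
        simp
  obtain ⟨Φ, h1, h2, h3⟩ := key q hq
  refine ⟨Φ, h1, h2, fun t => ?_⟩
  have h4 := (ContinuousMap.dist_apply_le_dist (f := G) (g := q) t).trans_lt hqG
  rw [h3, abs_sub_comm]
  refine lt_of_le_of_lt ?_ h4
  rw [dist_eq_norm]
  simpa [G] using Complex.abs_re_le_norm (G t - q t)

/-- A continuous nonnegative function on `𝕋` is, up to a small error, the real part of an analytic
function whose `L²` norm it controls. -/
lemma exists_analytic_majorant {g : 𝕋 → ℝ} (hg : Continuous g) {η : ℝ}
    (hη : 0 < η) :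
    ∃ Φ : ℂ → ℂ, Differentiable ℂ Φ ∧ (∀ t, g t < (Φ (circlePt t)).re) ∧
      ∫ t, ‖Φ (circlePt t)‖ ^ 2 ∂μ𝕋 ≤ 4 * ∫ t, g t ^ 2 ∂μ𝕋 + η := by
  obtain ⟨δ, hδ0, hδ2⟩ : ∃ δ : ℝ, 0 < δ ∧ δ ^ 2 = η / 16 :=
    ⟨√(η / 16), by positivity, Real.sq_sqrt (by positivity)⟩
  obtain ⟨Φ, h1, h2, h3⟩ := exists_re_approx (g := fun t => g t + δ) (by fun_prop) hδ0
  refine ⟨Φ, h1, fun t => by linarith [(abs_lt.1 (h3 t)).1], ?_⟩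
  have hc : Continuous fun t => Φ (circlePt t) := h1.continuous.comp continuous_circlePt
  have hsq : Continuous fun t => Φ (circlePt t) ^ 2 := hc.pow 2
  have hsqn : Continuous fun t => ‖Φ (circlePt t)‖ ^ 2 := hc.norm.pow 2
  have hint : ∫ t, Φ (circlePt t) ^ 2 ∂μ𝕋 = Φ 0 ^ 2 :=
    integral_boundary (h := fun z => Φ z ^ 2) (h1.pow 2).diffContOnCl
  have hre : 0 ≤ ∫ t, (Φ (circlePt t) ^ 2).re ∂μ𝕋 := by
    rw [show ∫ t, (Φ (circlePt t) ^ 2).re ∂μ𝕋 = (∫ t, Φ (circlePt t) ^ 2 ∂μ𝕋).re from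
      integral_re (integrable_of_continuous hsq), hint, sq, Complex.mul_re, h2]
    nlinarith [sq_nonneg (Φ 0).re]
  have hpt : ∀ t, ‖Φ (circlePt t)‖ ^ 2 ≤
      4 * g t ^ 2 + η - (Φ (circlePt t) ^ 2).re := by
    intro t
    have h4 := abs_lt.1 (h3 t)
    rw [Complex.sq_norm, Complex.normSq_apply, sq (Φ _), Complex.mul_re]
    generalize (Φ (circlePt t)).re = a at h4 ⊢
    generalize (Φ (circlePt t)).im = b
    have h5 : (a - g t) ^ 2 ≤ 4 * δ ^ 2 := by nlinarith
    nlinarith [sq_nonneg (g t - (a - g t))]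
  have hi1 : Integrable (fun t => 4 * g t ^ 2 + η) μ𝕋 := integrable_of_continuous (by fun_prop)
  have hi2 : Integrable (fun t => (Φ (circlePt t) ^ 2).re) μ𝕋 :=
    integrable_of_continuous (Complex.continuous_re.comp hsq)
  have hi3 : Integrable (fun t => 4 * g t ^ 2) μ𝕋 := integrable_of_continuous (by fun_prop)
  have h6 := integral_mono (integrable_of_continuous hsqn) (hi1.sub hi2) hpt
  simp only [Pi.sub_apply] at h6
  rw [integral_sub hi1 hi2, integral_add hi3 (integrable_const η), integral_const_mul] at h6
  simp only [integral_const, probReal_univ, smul_eq_mul, one_mul] at h6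
  linarith

/-- The minimum principle for the real part. -/
lemma re_pos_of_boundary {Φ : ℂ → ℂ} (hΦ : Differentiable ℂ Φ)
    (h : ∀ t, 0 < (Φ (circlePt t)).re) {z : ℂ} (hz : z ∈ Metric.closedBall (0 : ℂ) 1) :
    0 < (Φ z).re := by
  have hc : Continuous fun t => (Φ (circlePt t)).re :=
    Complex.continuous_re.comp (hΦ.continuous.comp continuous_circlePt)
  obtain ⟨t₀, -, ht₀⟩ := isCompact_univ.exists_isMinOn ⟨(0 : 𝕋), trivial⟩ hc.continuousOn
  have hmax := Complex.norm_le_of_forall_mem_frontier_norm_le (f := fun z => Complex.exp (-Φ z))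
    (U := Metric.ball 0 1) Metric.isBounded_ball (Differentiable.diffContOnCl (by fun_prop))
    (C := Real.exp (-(Φ (circlePt t₀)).re)) (by
      intro z hz
      rw [frontier_ball (0 : ℂ) one_ne_zero] at hz
      obtain ⟨t, rfl⟩ := exists_circlePt_eq (z := z) (by simpa using hz)
      rw [Complex.norm_exp, Real.exp_le_exp, Complex.neg_re, neg_le_neg_iff]
      exact ht₀ (Set.mem_univ t)) (z := z) (by rwa [closure_ball (0 : ℂ) one_ne_zero])
  rw [Complex.norm_exp, Real.exp_le_exp, Complex.neg_re, neg_le_neg_iff] at hmax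
  exact (h t₀).trans_le hmax

/-- Size estimates for the truncating function `s ↦ (1 + 3 s) / (1 + s) ^ 3` on the right
half-plane. -/
lemma truncation_bounds {s : ℂ} (hs : 0 ≤ s.re) :
    ‖(1 + 3 * s) / (1 + s) ^ 3‖ * (1 + ‖s‖ ^ 2) ≤ 3 ∧
      ‖1 - (1 + 3 * s) / (1 + s) ^ 3‖ ≤ 3 * ‖s‖ ^ 2 ∧
      ‖1 - (1 + 3 * s) / (1 + s) ^ 3‖ ≤ 4 := by
  have h1 : 1 + ‖s‖ ^ 2 ≤ ‖1 + s‖ ^ 2 := by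
    rw [Complex.sq_norm, Complex.sq_norm, Complex.normSq_apply, Complex.normSq_apply]
    simp only [Complex.add_re, Complex.one_re, Complex.add_im, Complex.one_im]
    nlinarith
  have h3 : ‖1 + 3 * s‖ ≤ 3 * ‖1 + s‖ := by
    refine abs_le_of_sq_le_sq' ?_ (by positivity) |>.2
    rw [mul_pow, Complex.sq_norm, Complex.sq_norm, Complex.normSq_apply, Complex.normSq_apply]
    simp only [Complex.add_re, Complex.one_re, Complex.add_im, Complex.one_im, Complex.mul_re,
      Complex.mul_im, Complex.re_ofNat, Complex.im_ofNat]
    nlinarith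
  have h2 : 1 ≤ ‖1 + s‖ := by nlinarith [norm_nonneg (1 + s), sq_nonneg ‖s‖]
  have h0 : (1 + s) ≠ 0 := norm_pos_iff.1 (by linarith)
  have h4 : ‖(1 + 3 * s) / (1 + s) ^ 3‖ ≤ 3 / ‖1 + s‖ ^ 2 := by
    rw [norm_div, norm_pow, div_le_div_iff₀ (by positivity) (by positivity)]
    nlinarith [sq_nonneg ‖1 + s‖]
  have h5 : ‖(1 + 3 * s) / (1 + s) ^ 3‖ * (1 + ‖s‖ ^ 2) ≤ 3 := by
    calc _ ≤ 3 / ‖1 + s‖ ^ 2 * ‖1 + s‖ ^ 2 := by gcongr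
      _ = 3 := by field_simp
  refine ⟨h5, ?_, ?_⟩
  · have h6 : 1 - (1 + 3 * s) / (1 + s) ^ 3 = s ^ 2 * ((3 + s) / (1 + s) ^ 3) := by
      field_simp
      ring
    have h7 : ‖3 + s‖ ≤ 3 * ‖1 + s‖ := by
      calc ‖3 + s‖ = ‖2 + (1 + s)‖ := by ring_nf
        _ ≤ ‖(2 : ℂ)‖ + ‖1 + s‖ := norm_add_le _ _
        _ ≤ _ := by simp only [Complex.norm_ofNat]; linarith
    rw [h6, norm_mul, norm_pow, norm_div, norm_pow, mul_comm]
    gcongr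
    rw [div_le_iff₀ (by positivity)]
    nlinarith [mul_le_mul h2 h2 zero_le_one (by positivity), sq_nonneg ‖1 + s‖]
  · calc _ ≤ ‖(1 : ℂ)‖ + ‖(1 + 3 * s) / (1 + s) ^ 3‖ := norm_sub_le _ _
      _ ≤ 1 + 3 := by
        rw [norm_one]
        nlinarith [norm_nonneg ((1 + 3 * s) / (1 + s) ^ 3), sq_nonneg ‖s‖]
      _ = 4 := by norm_num

lemma exp_half_log_sub {a b : ℂ} (ha : 0 < a.re) (hb : 0 < b.re) :
    0 ≤ (Complex.exp ((Complex.log a - Complex.log b) / 2)).re ∧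
      ‖Complex.exp ((Complex.log a - Complex.log b) / 2)‖ ^ 2 = ‖a‖ / ‖b‖ := by
  have ha0 : a ≠ 0 := by rintro rfl; simp at ha
  have hb0 : b ≠ 0 := by rintro rfl; simp at hb
  have h1 := abs_lt.1 (Complex.abs_arg_lt_pi_div_two_iff.2 (Or.inl ha))
  have h2 := abs_lt.1 (Complex.abs_arg_lt_pi_div_two_iff.2 (Or.inl hb))
  constructor
  · rw [Complex.exp_re]
    refine mul_nonneg (Real.exp_pos _).le (Real.cos_nonneg_of_mem_Icc ?_)
    have : ((Complex.log a - Complex.log b) / 2).im = (a.arg - b.arg) / 2 := by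
      simp [Complex.log_im]
    rw [this]
    constructor <;> linarith
  · rw [← norm_pow, ← Complex.exp_nat_mul]
    rw [show ((2 : ℕ) : ℂ) * ((Complex.log a - Complex.log b) / 2)
      = Complex.log a - Complex.log b by push_cast; ring]
    rw [Complex.exp_sub, Complex.exp_log ha0, Complex.exp_log hb0, norm_div]

/-- Pointwise estimates behind the analytic truncation: `D`, `r`, `P`, `T`, `S` stand for the moduli
of the function to be split, of the weight, of the majorant, of the truncation and of its
complement. -/
lemma truncation_pointwise {D r P T S : ℝ} (hD : 0 ≤ D) (hr : 0 < r) (hP : 0 ≤ P) (hT : 0 ≤ T)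
    (hPD : D - r ^ 2 ≤ P ^ 2) (h1 : T * (1 + P / r) ≤ 3) (h2 : S ≤ 3 * (P / r)) (h3 : S ≤ 4) :
    D * S + (D * T) ^ 2 / r ^ 2 ≤ 13 * (D ^ 2 / max (r ^ 2) D) + 2 * P ^ 2 := by
  have hm : 0 < max (r ^ 2) D := lt_max_of_lt_left (by positivity)
  have e1 : (D * T) ^ 2 / r ^ 2 ≤ 9 * (D ^ 2 / max (r ^ 2) D) := by
    have h4 : T * (r + P) ≤ 3 * r := by
      calc T * (r + P) = T * (1 + P / r) * r := by field_simp
        _ ≤ 3 * r := by gcongr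
    have h5 : T ^ 2 * (r + P) ^ 2 ≤ 9 * r ^ 2 := by
      calc T ^ 2 * (r + P) ^ 2 = (T * (r + P)) ^ 2 := by ring
        _ ≤ (3 * r) ^ 2 := by gcongr
        _ = _ := by ring
    have h6 : max (r ^ 2) D ≤ (r + P) ^ 2 := max_le (by nlinarith [mul_nonneg hr.le hP])
      (by nlinarith [mul_nonneg hr.le hP])
    have h7 : T ^ 2 * max (r ^ 2) D ≤ 9 * r ^ 2 := (by gcongr : _ ≤ T ^ 2 * (r + P) ^ 2).trans h5
    rw [← mul_div_assoc, div_le_div_iff₀ (by positivity) hm]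
    calc _ = D ^ 2 * (T ^ 2 * max (r ^ 2) D) := by ring
      _ ≤ D ^ 2 * (9 * r ^ 2) := by gcongr
      _ = _ := by ring
  have e2 : D * S ≤ 4 * (D ^ 2 / max (r ^ 2) D) + 2 * P ^ 2 := by
    rcases le_total (r ^ 2) D with h | h
    · have hD0 : 0 < D := lt_of_lt_of_le (by positivity) h
      rw [max_eq_right h, sq D, mul_self_div_self]
      nlinarith [sq_nonneg P]
    · rw [max_eq_left h]
      have h8 : D * S ≤ 3 * (D / r) * P := by
        calc D * S ≤ D * (3 * (P / r)) := by gcongr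
          _ = _ := by field_simp
      rw [← div_pow]
      nlinarith [sq_nonneg (D / r - P), sq_nonneg (D / r), sq_nonneg P]
  linarith

/-- Analytic truncation: an analytic function splits into an integrable part and a part which
is square integrable for the weight `‖φ‖ ^ (-2)`, with the optimal norm control. -/
lemma exists_analytic_splitting {φ d : ℂ → ℂ} (hφ : Differentiable ℂ φ)
    (hφ0 : ∀ t, 0 < (φ (circlePt t)).re) (hd : DiffContOnCl ℂ d (Metric.ball 0 1))
    {δ : ℝ} (hδ : 0 < δ) :
    ∃ e : ℂ → ℂ, DiffContOnCl ℂ e (Metric.ball 0 1) ∧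
      ∫ t, (‖e (circlePt t)‖ +
          ‖d (circlePt t) - e (circlePt t)‖ ^ 2 / ‖φ (circlePt t)‖ ^ 2) ∂μ𝕋 ≤
        21 * ∫ t, ‖d (circlePt t)‖ ^ 2 / max (‖φ (circlePt t)‖ ^ 2) ‖d (circlePt t)‖ ∂μ𝕋
          + δ := by
  have hdc := continuous_boundary hd
  have hφc : Continuous fun t => φ (circlePt t) := hφ.continuous.comp continuous_circlePt
  have hφn : ∀ t, 0 < ‖φ (circlePt t)‖ := fun t =>
    (hφ0 t).trans_le ((le_abs_self _).trans (Complex.abs_re_le_norm _))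
  have hgc : Continuous fun t => √(‖d (circlePt t)‖ - ‖φ (circlePt t)‖ ^ 2) := by
    have := hdc.norm
    have := hφc.norm
    fun_prop
  obtain ⟨Φ, hΦ, hΦg, hΦi⟩ := exists_analytic_majorant hgc (half_pos hδ)
  have hΦ0 : ∀ t, 0 < (Φ (circlePt t)).re := fun t => (Real.sqrt_nonneg _).trans_lt (hΦg t)
  have hΦc : Continuous fun t => Φ (circlePt t) := hΦ.continuous.comp continuous_circlePt
  let s : ℂ → ℂ := fun z => Complex.exp ((Complex.log (Φ z) - Complex.log (φ z)) / 2)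
  let τ : ℂ → ℂ := fun z => (1 + 3 * s z) / (1 + s z) ^ 3
  have hs : ∀ z ∈ Metric.closedBall (0 : ℂ) 1, DifferentiableAt ℂ s z := by
    intro z hz
    have h1 := re_pos_of_boundary hΦ hΦ0 hz
    have h2 := re_pos_of_boundary hφ hφ0 hz
    exact ((((hΦ z).clog (Or.inl h1)).sub ((hφ z).clog (Or.inl h2))).div_const 2).cexp
  have hsre : ∀ z ∈ Metric.closedBall (0 : ℂ) 1, 0 ≤ (s z).re := fun z hz =>
    (exp_half_log_sub (re_pos_of_boundary hΦ hΦ0 hz) (re_pos_of_boundary hφ hφ0 hz)).1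
  have hτ : ∀ z ∈ Metric.closedBall (0 : ℂ) 1, DifferentiableAt ℂ τ z := by
    intro z hz
    have h1 : 1 + s z ≠ 0 := by
      intro h
      have := congrArg Complex.re h
      simp only [Complex.add_re, Complex.one_re, Complex.zero_re] at this
      linarith [hsre z hz]
    have := hs z hz
    exact DifferentiableAt.div (by fun_prop) (by fun_prop) (pow_ne_zero _ h1)
  have hτd : DiffContOnCl ℂ τ (Metric.ball 0 1) :=
    DifferentiableOn.diffContOnCl (by
      rw [closure_ball (0 : ℂ) one_ne_zero]
      exact fun z hz => (hτ z hz).differentiableWithinAt)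
  have he : DiffContOnCl ℂ (fun z => (1 - τ z) • d z) (Metric.ball 0 1) :=
    (diffContOnCl_const.sub hτd).smul hd
  refine ⟨fun z => (1 - τ z) • d z, he, ?_⟩
  have hpt : ∀ t, ‖(1 - τ (circlePt t)) • d (circlePt t)‖ +
      ‖d (circlePt t) - (1 - τ (circlePt t)) • d (circlePt t)‖ ^ 2 / ‖φ (circlePt t)‖ ^ 2 ≤
      13 * (‖d (circlePt t)‖ ^ 2 / max (‖φ (circlePt t)‖ ^ 2) ‖d (circlePt t)‖) +
        2 * ‖Φ (circlePt t)‖ ^ 2 := by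
    intro t
    have hs2 := (exp_half_log_sub (hΦ0 t) (hφ0 t)).2
    obtain ⟨b1, b2, b3⟩ := truncation_bounds (hsre _ (circlePt_mem_closedBall t))
    rw [show ‖s (circlePt t)‖ ^ 2 = ‖Φ (circlePt t)‖ / ‖φ (circlePt t)‖ from hs2] at b1 b2
    have hP : ‖d (circlePt t)‖ - ‖φ (circlePt t)‖ ^ 2 ≤ ‖Φ (circlePt t)‖ ^ 2 := by
      have h1 : √(‖d (circlePt t)‖ - ‖φ (circlePt t)‖ ^ 2) ≤ ‖Φ (circlePt t)‖ :=
        (hΦg t).le.trans ((le_abs_self _).trans (Complex.abs_re_le_norm _))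
      exact (Real.sqrt_le_left (norm_nonneg _)).1 h1
    have := truncation_pointwise (norm_nonneg _) (hφn t) (norm_nonneg _) (norm_nonneg _)
      hP b1 b2 b3
    refine le_trans (le_of_eq ?_) this
    rw [show d (circlePt t) - (1 - τ (circlePt t)) • d (circlePt t)
      = d (circlePt t) * τ (circlePt t) by simp only [smul_eq_mul]; ring, norm_mul, smul_eq_mul,
      norm_mul, mul_comm ‖1 - _‖]
  have hmc : Continuous fun t =>
      ‖d (circlePt t)‖ ^ 2 / max (‖φ (circlePt t)‖ ^ 2) ‖d (circlePt t)‖ :=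
    (hdc.norm.pow 2).div ((hφc.norm.pow 2).max hdc.norm)
      fun t => (lt_max_of_lt_left (pow_pos (hφn t) 2)).ne'
  have hec := continuous_boundary he
  have hg2 : ∫ t, √(‖d (circlePt t)‖ - ‖φ (circlePt t)‖ ^ 2) ^ 2 ∂μ𝕋 ≤
      ∫ t, ‖d (circlePt t)‖ ^ 2 / max (‖φ (circlePt t)‖ ^ 2) ‖d (circlePt t)‖ ∂μ𝕋 := by
    refine integral_mono (integrable_of_continuous (hgc.pow 2)) (integrable_of_continuous hmc)
      fun t => ?_
    have h0 : 0 < ‖φ (circlePt t)‖ ^ 2 := pow_pos (hφn t) 2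
    beta_reduce
    rcases le_total ‖d (circlePt t)‖ (‖φ (circlePt t)‖ ^ 2) with h | h
    · rw [Real.sqrt_eq_zero'.2 (by linarith), zero_pow two_ne_zero]
      exact div_nonneg (sq_nonneg _) (le_max_of_le_left h0.le)
    · rw [Real.sq_sqrt (by linarith), max_eq_right h, sq ‖d _‖, mul_self_div_self]
      linarith
  have hi1 := (integrable_of_continuous hmc).const_mul 13
  have hi2 : Integrable (fun t => 2 * ‖Φ (circlePt t)‖ ^ 2) μ𝕋 :=
    (integrable_of_continuous (hΦc.norm.pow 2)).const_mul 2
  have h6 := integral_mono (integrable_of_continuous (hec.norm.add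
    (((hdc.sub hec).norm.pow 2).div (hφc.norm.pow 2) fun t => (pow_pos (hφn t) 2).ne')))
    (hi1.add hi2) hpt
  refine h6.trans ?_
  rw [integral_add' hi1 hi2, integral_const_mul, integral_const_mul]
  linarith

lemma sq_div_max_le {a b c : ℝ} {v : ℝ} (hv : 0 < v) (hb : 0 ≤ b) (hc : 0 ≤ c)
    (h : c ≤ a + b) : c ^ 2 / max v c ≤ 2 * b + 4 * (a ^ 2 / v) := by
  have hm : 0 < max v c := lt_max_of_lt_left hv
  rcases le_total c (2 * b) with h1 | h1
  · have : c ^ 2 / max v c ≤ c := by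
      rw [div_le_iff₀ hm, sq]
      exact mul_le_mul_of_nonneg_left (le_max_right _ _) hc
    have : 0 ≤ a ^ 2 / v := by positivity
    linarith
  · have : c ^ 2 / max v c ≤ 4 * (a ^ 2 / v) := by
      calc c ^ 2 / max v c ≤ (2 * a) ^ 2 / v :=
            div_le_div₀ (by positivity) (by gcongr; linarith) hv (le_max_left _ _)
        _ = _ := by ring
    linarith

lemma sqrt_sum_sq_sub_le {n : ℕ} (a b : ℕ → ℂ) :
    √(∑ k ∈ Finset.range n, ‖a k - b k‖ ^ 2) ≤
      2 * (√(∑ k ∈ Finset.range n, ‖a k‖ ^ 2) + √(∑ k ∈ Finset.range n, ‖b k‖ ^ 2)) := by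
  rw [Real.sqrt_le_left (by positivity)]
  have h1 := Real.sq_sqrt (Finset.sum_nonneg (s := Finset.range n) fun k _ => sq_nonneg ‖a k‖)
  have h2 := Real.sq_sqrt (Finset.sum_nonneg (s := Finset.range n) fun k _ => sq_nonneg ‖b k‖)
  have h3 : ∑ k ∈ Finset.range n, ‖a k - b k‖ ^ 2 ≤
      2 * ∑ k ∈ Finset.range n, ‖a k‖ ^ 2 + 2 * ∑ k ∈ Finset.range n, ‖b k‖ ^ 2 := by
    rw [Finset.mul_sum, Finset.mul_sum, ← Finset.sum_add_distrib]
    refine Finset.sum_le_sum fun k _ => ?_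
    have := norm_sub_le (a k) (b k)
    nlinarith [sq_nonneg (‖a k‖ - ‖b k‖), norm_nonneg (a k - b k)]
  nlinarith [mul_nonneg (Real.sqrt_nonneg (∑ k ∈ Finset.range n, ‖a k‖ ^ 2))
    (Real.sqrt_nonneg (∑ k ∈ Finset.range n, ‖b k‖ ^ 2))]

/-- A common representative: if `F` and `G` differ by analytic functions, there is a sequence in the
same class whose `L¹(ℓ₂)` norm is controlled by that of `F` and whose `L¹(ℓ₁)` norm
is controlled by that of `G`. -/
lemma exists_common_representative (n : ℕ) {F G : ℕ → 𝕋 → ℂ} {d : ℕ → ℂ → ℂ}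
    (hG : ∀ k, Continuous (G k)) (hd : ∀ k, DiffContOnCl ℂ (d k) (Metric.ball 0 1))
    (hFG : ∀ k t, F k t = G k t + d k (circlePt t)) {A B : ℝ}
    (hA : ∫ t, √(∑ k ∈ Finset.range n, ‖F k t‖ ^ 2) ∂μ𝕋 < A)
    (hB : ∫ t, ∑ k ∈ Finset.range n, ‖G k t‖ ∂μ𝕋 < B) :
    ∃ e : ℕ → ℂ → ℂ, (∀ k, DiffContOnCl ℂ (e k) (Metric.ball 0 1)) ∧
      ∫ t, √(∑ k ∈ Finset.range n, ‖G k t + e k (circlePt t)‖ ^ 2) ∂μ𝕋 ≤ 136 * A ∧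
      ∫ t, ∑ k ∈ Finset.range n, ‖G k t + e k (circlePt t)‖ ∂μ𝕋 ≤ 136 * B := by
  have hdc := fun k => continuous_boundary (hd k)
  have hF : ∀ k, Continuous (F k) := fun k => by
    rw [funext (hFG k)]
    exact (hG k).add (hdc k)
  have hA0 : 0 < A := (integral_nonneg fun t => Real.sqrt_nonneg _).trans_lt hA
  have hB0 : 0 < B :=
    (integral_nonneg fun t => Finset.sum_nonneg fun k _ => norm_nonneg (G k t)).trans_lt hB
  set N : 𝕋 → ℝ := fun t => √(∑ k ∈ Finset.range n, ‖F k t‖ ^ 2) with hN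
  have hNc : Continuous N := by fun_prop
  obtain ⟨ε, hε, hεA⟩ : ∃ ε > 0, (∫ t, N t ∂μ𝕋) + ε = A :=
    ⟨A - ∫ t, N t ∂μ𝕋, sub_pos.2 hA, by ring⟩
  set w : 𝕋 → ℝ := fun t => N t + ε with hw
  have hwc : Continuous w := by fun_prop
  have hw0 : ∀ t, 0 < w t := fun t => add_pos_of_nonneg_of_pos (Real.sqrt_nonneg _) hε
  have hwi : ∫ t, w t ∂μ𝕋 = A := by
    rw [hw, integral_add (integrable_of_continuous hNc) (integrable_const _)]
    simpa using hεA
  set l := A / B with hl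
  have hl0 : 0 < l := div_pos hA0 hB0
  have hlw : ∀ t, √(l * w t) ^ 2 = l * w t := fun t => Real.sq_sqrt (mul_pos hl0 (hw0 t)).le
  obtain ⟨φ, hφ, hφw, hφi⟩ := exists_analytic_majorant (g := fun t => √(l * w t)) (by fun_prop)
    (mul_pos hl0 hA0)
  have hφ0 : ∀ t, 0 < (φ (circlePt t)).re := fun t => (Real.sqrt_nonneg _).trans_lt (hφw t)
  simp only [hlw, integral_const_mul, hwi] at hφi
  set V : 𝕋 → ℝ := fun t => ‖φ (circlePt t)‖ ^ 2 with hV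
  have hVc : Continuous V := (hφ.continuous.comp continuous_circlePt).norm.pow 2
  have hVw : ∀ t, l * w t ≤ V t := fun t => by
    rw [← hlw]
    have := (hφw t).le.trans ((le_abs_self _).trans (Complex.abs_re_le_norm _))
    simp only [hV]
    gcongr
  have hV0 : ∀ t, 0 < V t := fun t => (mul_pos hl0 (hw0 t)).trans_le (hVw t)
  choose e he hei using fun k => exists_analytic_splitting hφ hφ0 (hd k)
    (δ := B / (n + 1)) (by positivity)
  have hec := fun k => continuous_boundary (he k)
  have hVne : ∀ t, V t ≠ 0 := fun t => (hV0 t).ne'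
  have hX1 : ∀ k, Continuous fun t => ‖d k (circlePt t) - e k (circlePt t)‖ ^ 2 / V t :=
    fun k => (((hdc k).sub (hec k)).norm.pow 2).div hVc hVne
  have hm : ∀ k, Continuous fun t =>
      ‖d k (circlePt t)‖ ^ 2 / max (V t) ‖d k (circlePt t)‖ := fun k =>
    ((hdc k).norm.pow 2).div (hVc.max (hdc k).norm) fun t => (lt_max_of_lt_left (hV0 t)).ne'
  set E1 : 𝕋 → ℝ := fun t => ∑ k ∈ Finset.range n, ‖e k (circlePt t)‖ with hE1
  set X : 𝕋 → ℝ := fun t =>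
    ∑ k ∈ Finset.range n, ‖d k (circlePt t) - e k (circlePt t)‖ ^ 2 / V t with hX
  have hE1c : Continuous E1 := continuous_finsetSum _ fun k _ => (hec k).norm
  have hXc : Continuous X := continuous_finsetSum _ fun k _ => hX1 k
  have hmsum : ∑ k ∈ Finset.range n,
      ∫ t, ‖d k (circlePt t)‖ ^ 2 / max (V t) ‖d k (circlePt t)‖ ∂μ𝕋 ≤ 6 * B := by
    rw [← integral_finsetSum _ fun k _ => integrable_of_continuous (hm k)]
    have hGs : Continuous fun t => ∑ k ∈ Finset.range n, ‖G k t‖ := by fun_prop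
    have h1 : ∀ t, ∑ k ∈ Finset.range n, ‖d k (circlePt t)‖ ^ 2 / max (V t) ‖d k (circlePt t)‖
        ≤ 2 * (∑ k ∈ Finset.range n, ‖G k t‖) + 4 * (l⁻¹ * w t) := by
      intro t
      have h2 : ∑ k ∈ Finset.range n, ‖F k t‖ ^ 2 / V t ≤ l⁻¹ * w t := by
        rw [← Finset.sum_div, div_le_iff₀ (hV0 t)]
        have h3 : ∑ k ∈ Finset.range n, ‖F k t‖ ^ 2 = N t ^ 2 :=
          (Real.sq_sqrt (Finset.sum_nonneg fun k _ => sq_nonneg _)).symm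
        have h4 : N t ^ 2 ≤ w t ^ 2 := by
          have : 0 ≤ N t := Real.sqrt_nonneg _
          gcongr
          simp only [hw]; linarith
        calc _ ≤ w t ^ 2 := h3.le.trans h4
          _ = l⁻¹ * w t * (l * w t) := by field_simp
          _ ≤ _ := mul_le_mul_of_nonneg_left (hVw t) (by have := hw0 t; positivity)
      calc _ ≤ ∑ k ∈ Finset.range n, (2 * ‖G k t‖ + 4 * (‖F k t‖ ^ 2 / V t)) := by
            refine Finset.sum_le_sum fun k _ => sq_div_max_le (hV0 t) (norm_nonneg _)
              (norm_nonneg _) ?_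
            rw [show d k (circlePt t) = F k t - G k t by rw [hFG]; ring]
            exact norm_sub_le _ _
        _ = 2 * (∑ k ∈ Finset.range n, ‖G k t‖) + 4 * ∑ k ∈ Finset.range n, ‖F k t‖ ^ 2 / V t := by
            rw [Finset.sum_add_distrib, Finset.mul_sum, Finset.mul_sum]
        _ ≤ _ := by gcongr
    have hi1 : Integrable (fun t => 2 * ∑ k ∈ Finset.range n, ‖G k t‖) μ𝕋 :=
      integrable_of_continuous (by fun_prop)
    have hi2 : Integrable (fun t => 4 * (l⁻¹ * w t)) μ𝕋 :=
      integrable_of_continuous (by fun_prop)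
    refine (integral_mono (integrable_of_continuous (continuous_finsetSum _ fun k _ => hm k))
      (hi1.add hi2) h1).trans ?_
    rw [integral_add' hi1 hi2, integral_const_mul, integral_const_mul, integral_const_mul, hwi]
    have : l⁻¹ * A = B := by rw [hl]; field_simp
    rw [this]
    linarith
  have hEX : (∫ t, E1 t ∂μ𝕋) + ∫ t, X t ∂μ𝕋 ≤ 127 * B := by
    rw [← integral_add (integrable_of_continuous hE1c) (integrable_of_continuous hXc)]
    simp only [hE1, hX, ← Finset.sum_add_distrib]
    have hs : ∀ k, Continuous fun t =>
        ‖e k (circlePt t)‖ + ‖d k (circlePt t) - e k (circlePt t)‖ ^ 2 / V t :=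
      fun k => (hec k).norm.add (hX1 k)
    rw [integral_finsetSum _ fun k _ => integrable_of_continuous (hs k)]
    calc _ ≤ ∑ k ∈ Finset.range n, (21 * (∫ t, ‖d k (circlePt t)‖ ^ 2 /
            max (V t) ‖d k (circlePt t)‖ ∂μ𝕋) + B / (n + 1)) :=
          Finset.sum_le_sum fun k _ => hei k
      _ ≤ 21 * (6 * B) + B := by
          rw [Finset.sum_add_distrib, ← Finset.mul_sum, Finset.sum_const, Finset.card_range,
            nsmul_eq_mul]
          have : (n : ℝ) * (B / (n + 1)) ≤ B := by
            rw [← mul_div_assoc, div_le_iff₀ (by positivity)]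
            nlinarith
          gcongr
      _ = _ := by ring
  have hE0 : 0 ≤ ∫ t, E1 t ∂μ𝕋 :=
    integral_nonneg fun t => Finset.sum_nonneg fun k _ => norm_nonneg _
  have hXn : ∀ t, 0 ≤ X t := fun t =>
    Finset.sum_nonneg fun k _ => div_nonneg (sq_nonneg _) (hV0 t).le
  have hX0 : 0 ≤ ∫ t, X t ∂μ𝕋 := integral_nonneg hXn
  have hWc : ∀ k, Continuous fun t => G k t + e k (circlePt t) := fun k => (hG k).add (hec k)
  refine ⟨e, he, ?_, ?_⟩
  · have hpt : ∀ t, √(∑ k ∈ Finset.range n, ‖G k t + e k (circlePt t)‖ ^ 2) ≤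
        2 * N t + (l * X t + l⁻¹ * V t) := by
      intro t
      have h1 := sqrt_sum_sq_sub_le (n := n) (fun k => F k t)
        (fun k => d k (circlePt t) - e k (circlePt t))
      have h2 : ∀ k, F k t - (d k (circlePt t) - e k (circlePt t)) = G k t + e k (circlePt t) :=
        fun k => by rw [hFG]; ring
      simp only [h2] at h1
      refine h1.trans ?_
      have h3 : √(∑ k ∈ Finset.range n, ‖d k (circlePt t) - e k (circlePt t)‖ ^ 2) ≤
          (l * X t + l⁻¹ * V t) / 2 := by
        have h4 : ∑ k ∈ Finset.range n, ‖d k (circlePt t) - e k (circlePt t)‖ ^ 2 = X t * V t := by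
          simp only [hX, Finset.sum_mul]
          exact Finset.sum_congr rfl fun k _ => (div_mul_cancel₀ _ (hVne t)).symm
        have h5 := hXn t
        have h6 := (hV0 t).le
        rw [h4, Real.sqrt_le_left (by positivity)]
        have h7 : X t * V t = (l * X t) * (l⁻¹ * V t) := by field_simp
        rw [h7]
        nlinarith [sq_nonneg (l * X t - l⁻¹ * V t)]
      linarith
    have hi1 : Integrable (fun t => 2 * N t) μ𝕋 := integrable_of_continuous (by fun_prop)
    have hi2 : Integrable (fun t => l * X t) μ𝕋 := integrable_of_continuous (by fun_prop)
    have hi3 : Integrable (fun t => l⁻¹ * V t) μ𝕋 := integrable_of_continuous (by fun_prop)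
    refine (integral_mono (integrable_of_continuous (by fun_prop))
      (hi1.add (hi2.add hi3)) hpt).trans ?_
    rw [integral_add' hi1 (hi2.add hi3), integral_add' hi2 hi3, integral_const_mul,
      integral_const_mul, integral_const_mul]
    have h8 : l * ∫ t, X t ∂μ𝕋 ≤ 127 * A := by
      calc _ ≤ l * (127 * B) := by gcongr; linarith
        _ = 127 * A := by rw [hl]; field_simp
    have h9 : l⁻¹ * ∫ t, V t ∂μ𝕋 ≤ 5 * A := by
      calc _ ≤ l⁻¹ * (4 * (l * A) + l * A) := by gcongr
        _ = 5 * A := by field_simp; ring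
    linarith
  · have hi1 : Integrable (fun t => ∑ k ∈ Finset.range n, ‖G k t‖) μ𝕋 :=
      integrable_of_continuous (by fun_prop)
    refine (integral_mono (integrable_of_continuous (by fun_prop))
      (hi1.add (integrable_of_continuous hE1c)) fun t => ?_).trans ?_
    · simp only [Pi.add_apply, hE1, ← Finset.sum_add_distrib]
      exact Finset.sum_le_sum fun k _ => norm_add_le _ _
    · rw [integral_add' hi1 (integrable_of_continuous hE1c)]
      linarith

/-- The Fejér mean of order `N` of a function on the circle. -/
def fejerMean (N : ℕ) (h : 𝕋 → ℂ) (t : 𝕋) : ℂ :=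
  ((N : ℂ) + 1)⁻¹ * ∑ j ∈ Finset.range (N + 1), ∑ k ∈ Finset.range (N + 1),
    fourierCoeff h ((j : ℤ) - k) * fourier ((j : ℤ) - k) t

/-- The analytic Dirichlet kernel. -/
def dirichletSum (N : ℕ) (t : 𝕋) : ℂ := ∑ j ∈ Finset.range (N + 1), fourier (j : ℤ) t

lemma continuous_dirichletSum (N : ℕ) : Continuous (dirichletSum N) :=
  continuous_finsetSum _ fun j _ => (fourier (j : ℤ)).continuous

lemma dirichletSum_mul_conj (N : ℕ) (t : 𝕋) :
    ((‖dirichletSum N t‖ ^ 2 : ℝ) : ℂ) = ∑ j ∈ Finset.range (N + 1),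
      ∑ k ∈ Finset.range (N + 1), fourier ((j : ℤ) - k) t := by
  rw [Complex.ofReal_pow, ← Complex.mul_conj', dirichletSum, map_sum, Finset.sum_mul_sum]
  refine Finset.sum_congr rfl fun j _ => Finset.sum_congr rfl fun k _ => ?_
  rw [sub_eq_add_neg, fourier_add, fourier_neg]

lemma fourierCoeff_sub_of_integrable {f g : 𝕋 → ℂ} (hf : Integrable f μ𝕋) (hg : Integrable g μ𝕋)
    (n : ℤ) : fourierCoeff (f - g) n = fourierCoeff f n - fourierCoeff g n := by
  have h := congrFun (fourierCoeff.add (hf.sub hg) hg) n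
  rw [sub_add_cancel] at h
  rw [h, Pi.add_apply, add_sub_cancel_right]

lemma fejerMean_sub (N : ℕ) {f g : 𝕋 → ℂ} (hf : Integrable f μ𝕋) (hg : Integrable g μ𝕋) (t : 𝕋) :
    fejerMean N (f - g) t = fejerMean N f t - fejerMean N g t := by
  simp only [fejerMean, fourierCoeff_sub_of_integrable hf hg, sub_mul, Finset.sum_sub_distrib, mul_sub]

lemma integral_fourier_eq (n : ℤ) : ∫ t, fourier n t ∂μ𝕋 = if n = 0 then 1 else 0 := by
  have h := congrFun (fourierCoeff_fourier (T := 2 * π) n) 0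
  simp only [fourierCoeff, neg_zero, fourier_zero, one_smul] at h
  rw [h, Pi.single_apply]
  simp [eq_comm]

lemma lintegral_dirichletSum_sq (N : ℕ) :
    ∫⁻ t, ‖dirichletSum N t‖ₑ ^ 2 ∂μ𝕋 = N + 1 := by
  have h1 : ∫ t, ‖dirichletSum N t‖ ^ 2 ∂μ𝕋 = N + 1 := by
    have h2 : ((∫ t, ‖dirichletSum N t‖ ^ 2 ∂μ𝕋 : ℝ) : ℂ) = N + 1 := by
      rw [← integral_complex_ofReal]
      simp only [dirichletSum_mul_conj]
      rw [integral_finsetSum _ fun j _ => integrable_of_continuous (by fun_prop)]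
      rw [Finset.sum_congr rfl fun j _ => integral_finsetSum (μ := μ𝕋) _ fun k _ =>
        integrable_of_continuous (by fun_prop)]
      simp only [integral_fourier_eq, sub_eq_zero, Nat.cast_inj]
      rw [Finset.sum_congr rfl fun j hj => by rw [Finset.sum_ite_eq, if_pos hj]]
      simp
    exact_mod_cast h2
  have h3 := ofReal_integral_eq_lintegral_ofReal (μ := μ𝕋)
    (f := fun t => ‖dirichletSum N t‖ ^ 2)
    (integrable_of_continuous ((continuous_dirichletSum N).norm.pow 2))
    (Filter.Eventually.of_forall fun t => sq_nonneg _)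
  rw [h1] at h3
  rw [ENNReal.ofReal_add (by positivity) zero_le_one, ENNReal.ofReal_natCast, ENNReal.ofReal_one]
    at h3
  rw [h3]
  refine lintegral_congr fun t => ?_
  rw [ENNReal.ofReal_pow (norm_nonneg _), ofReal_norm]

lemma fejerMean_eq_integral (N : ℕ) {h : 𝕋 → ℂ} (hh : Integrable h μ𝕋) (t : 𝕋) :
    fejerMean N h t =
      ((N : ℂ) + 1)⁻¹ * ∫ s, ((‖dirichletSum N (t - s)‖ ^ 2 : ℝ) : ℂ) * h s ∂μ𝕋 := by
  have hi : ∀ n : ℤ, Integrable (fun s => fourier n (t - s) * h s) μ𝕋 := fun n =>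
    hh.bdd_mul (c := 1) (by fun_prop) (Filter.Eventually.of_forall fun s => (Circle.norm_coe _).le)
  rw [fejerMean]
  congr 1
  simp only [dirichletSum_mul_conj, Finset.sum_mul]
  rw [integral_finsetSum _ fun j _ => integrable_finsetSum _ fun k _ => hi _]
  refine Finset.sum_congr rfl fun j _ => ?_
  rw [integral_finsetSum _ fun k _ => hi _]
  refine Finset.sum_congr rfl fun k _ => ?_
  rw [fourierCoeff, mul_comm, ← integral_const_mul]
  refine integral_congr_ae (Filter.Eventually.of_forall fun s => ?_)
  simp only [smul_eq_mul]
  rw [← mul_assoc]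
  congr 1
  simp only [fourier_apply, sub_eq_add_neg (t), smul_add, smul_neg, AddCircle.toCircle_add,
    Circle.coe_mul, neg_smul]

lemma lintegral_fejerMean_le (N : ℕ) {h : 𝕋 → ℂ} (hh : Integrable h μ𝕋) :
    ∫⁻ t, ‖fejerMean N h t‖ₑ ∂μ𝕋 ≤ ∫⁻ t, ‖h t‖ₑ ∂μ𝕋 := by
  have hN : ‖((N : ℂ) + 1)⁻¹‖ₑ = ((N : ℝ≥0∞) + 1)⁻¹ := by
    rw [enorm_inv (by exact_mod_cast N.succ_ne_zero)]
    congr 1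
    rw [← ofReal_norm]
    rw [show ((N : ℂ) + 1) = ((N + 1 : ℕ) : ℂ) by push_cast; rfl, Complex.norm_natCast,
      ENNReal.ofReal_natCast]
    push_cast; rfl
  have hD : Measurable (dirichletSum N) := (continuous_dirichletSum N).measurable
  calc ∫⁻ t, ‖fejerMean N h t‖ₑ ∂μ𝕋
      ≤ ∫⁻ t, ((N : ℝ≥0∞) + 1)⁻¹ * ∫⁻ s, ‖dirichletSum N (t - s)‖ₑ ^ 2 * ‖h s‖ₑ ∂μ𝕋 ∂μ𝕋 := by
        refine lintegral_mono fun t => ?_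
        rw [fejerMean_eq_integral N hh, enorm_mul, hN]
        gcongr
        refine (enorm_integral_le_lintegral_enorm _).trans (lintegral_mono fun s => ?_)
        rw [enorm_mul]
        gcongr
        rw [← ofReal_norm, ← ofReal_norm, Complex.norm_real, Real.norm_of_nonneg (sq_nonneg _),
          ENNReal.ofReal_pow (norm_nonneg _)]
    _ = ((N : ℝ≥0∞) + 1)⁻¹ *
          ∫⁻ s, (∫⁻ t, ‖dirichletSum N (t - s)‖ₑ ^ 2 ∂μ𝕋) * ‖h s‖ₑ ∂μ𝕋 := by
        rw [lintegral_const_mul' _ _ (by simp)]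
        rw [lintegral_lintegral_swap]
        · congr 1
          refine lintegral_congr fun s => ?_
          rw [lintegral_mul_const _ (by fun_prop)]
        · have h1 : Measurable fun x : 𝕋 × 𝕋 => ‖dirichletSum N (x.1 - x.2)‖ₑ ^ 2 := by fun_prop
          exact h1.aemeasurable.mul (hh.1.comp_snd).enorm
    _ = _ := by
        have h1 : ∀ s, ∫⁻ t, ‖dirichletSum N (t - s)‖ₑ ^ 2 ∂μ𝕋 = (N : ℝ≥0∞) + 1 := fun s => by
          rw [lintegral_sub_right_eq_self (fun t => ‖dirichletSum N t‖ₑ ^ 2) s,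
            lintegral_dirichletSum_sq]
        simp only [h1]
        rw [lintegral_const_mul' _ _ (by simp), ← mul_assoc, ENNReal.inv_mul_cancel (by simp)
          (by simp), one_mul]

lemma fejerMean_fourier_sub_le (n : ℤ) (N : ℕ) (t : 𝕋) :
    ‖fejerMean N (fourier n) t - fourier n t‖ ≤ 2 * n.natAbs / (N + 1) := by
  set S := (Finset.range (N + 1)).filter fun j : ℕ => ¬ (0 ≤ (j : ℤ) - n ∧ (j : ℤ) - n < N + 1)
    with hS
  have hcard : S.card ≤ 2 * n.natAbs := by
    have h1 : S ⊆ Finset.range n.natAbs ∪ Finset.Ico (N + 1 - n.natAbs) (N + 1) := fun j hj => by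
      simp only [hS, Finset.mem_filter, Finset.mem_range] at hj
      simp only [Finset.mem_union, Finset.mem_range, Finset.mem_Ico]
      omega
    refine (Finset.card_le_card h1).trans ((Finset.card_union_le _ _).trans ?_)
    simp only [Finset.card_range, Nat.card_Ico]
    omega
  have hinner : ∀ j ∈ Finset.range (N + 1), ∑ k ∈ Finset.range (N + 1),
      fourierCoeff (fourier n : C(𝕋, ℂ)) ((j : ℤ) - k) * fourier ((j : ℤ) - k) t =
      fourier n t - if ¬ (0 ≤ (j : ℤ) - n ∧ (j : ℤ) - n < N + 1) then fourier n t else 0 := by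
    intro j hj
    simp only [fourierCoeff_fourier, Pi.single_apply, ite_mul, one_mul, zero_mul]
    by_cases hc : 0 ≤ (j : ℤ) - n ∧ (j : ℤ) - n < N + 1
    · rw [if_neg (not_not.2 hc), sub_zero, Finset.sum_eq_single ((j : ℤ) - n).toNat]
      · rw [if_pos (by omega)]
        congr 1
        congr 1
        omega
      · intro k _ hk
        rw [if_neg (by omega)]
      · intro hk
        rw [Finset.mem_range] at hk
        omega
    · rw [if_pos hc, sub_self]
      refine Finset.sum_eq_zero fun k hk => if_neg ?_
      rw [Finset.mem_range] at hk
      omega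
  have hN : ((N : ℂ) + 1) ≠ 0 := by exact_mod_cast N.succ_ne_zero
  have h2 : fejerMean N (fourier n) t - fourier n t =
      -(((N : ℂ) + 1)⁻¹ * (S.card * fourier n t)) := by
    rw [fejerMean, Finset.sum_congr rfl hinner, Finset.sum_sub_distrib, ← Finset.sum_filter,
      Finset.sum_const, Finset.sum_const, Finset.card_range]
    simp only [nsmul_eq_mul]
    push_cast
    field_simp
    ring
  rw [h2, norm_neg, norm_mul, norm_mul, norm_inv,
    show ((N : ℂ) + 1) = ((N + 1 : ℕ) : ℂ) by push_cast; rfl, Complex.norm_natCast,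
    Complex.norm_natCast]
  have h3 : ‖fourier n t‖ = 1 := Circle.norm_coe _
  rw [h3, mul_one, inv_mul_eq_div]
  push_cast
  gcongr
  exact_mod_cast hcard

lemma exists_fejerMean_sub_le {q : C(𝕋, ℂ)}
    (hq : q ∈ Submodule.span ℂ (Set.range (fourier : ℤ → C(𝕋, ℂ)))) :
    ∃ K : ℝ, ∀ (N : ℕ) (t : 𝕋), ‖fejerMean N q t - q t‖ ≤ K / (N + 1) := by
  induction hq using Submodule.span_induction with
  | mem x hx =>
    obtain ⟨n, rfl⟩ := hx
    exact ⟨2 * n.natAbs, fun N t => fejerMean_fourier_sub_le n N t⟩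
  | zero => exact ⟨0, fun N t => by simp [fejerMean, fourierCoeff]⟩
  | add x y _ _ hx hy =>
    obtain ⟨K, hK⟩ := hx
    obtain ⟨L, hL⟩ := hy
    refine ⟨K + L, fun N t => ?_⟩
    have h1 : fejerMean N ⇑(x + y) t = fejerMean N x t + fejerMean N y t := by
      have h2 := fourierCoeff.add (integrable_of_continuous x.continuous)
        (integrable_of_continuous y.continuous)
      simp only [fejerMean, ContinuousMap.coe_add, h2, Pi.add_apply, add_mul,
        Finset.sum_add_distrib, mul_add]
    rw [h1, ContinuousMap.add_apply, add_sub_add_comm, add_div]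
    exact (norm_add_le _ _).trans (add_le_add (hK N t) (hL N t))
  | smul c x _ hx =>
    obtain ⟨K, hK⟩ := hx
    refine ⟨‖c‖ * K, fun N t => ?_⟩
    have h1 : fejerMean N ⇑(c • x) t = c * fejerMean N x t := by
      simp only [fejerMean, ContinuousMap.coe_smul, fourierCoeff.const_smul, smul_eq_mul, mul_assoc,
        ← Finset.mul_sum]
      ring
    rw [h1, ContinuousMap.smul_apply, smul_eq_mul, ← mul_sub, norm_mul, mul_div_assoc]
    exact mul_le_mul_of_nonneg_left (hK N t) (norm_nonneg _)

lemma exists_trigPolynomial_approx {h : 𝕋 → ℂ} (hh : Integrable h μ𝕋) {ε : ℝ≥0∞} (hε : ε ≠ 0) :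
    ∃ q ∈ Submodule.span ℂ (Set.range (fourier : ℤ → C(𝕋, ℂ))),
      ∫⁻ t, ‖h t - q t‖ₑ ∂μ𝕋 ≤ ε := by
  obtain ⟨r, hr0, hr⟩ : ∃ r : ℝ≥0, 0 < r ∧ (r : ℝ≥0∞) ≤ ε / 2 := by
    obtain ⟨r, hr0, hr⟩ := ENNReal.lt_iff_exists_nnreal_btwn.1 (ENNReal.half_pos hε)
    exact ⟨r, by exact_mod_cast hr0, hr.le⟩
  obtain ⟨g, -, hg, hgc, -⟩ := hh.exists_hasCompactSupport_lintegral_sub_le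
    (ENNReal.half_pos hε).ne'
  have hmem : (⟨g, hgc⟩ : C(𝕋, ℂ)) ∈
      (Submodule.span ℂ (Set.range (fourier : ℤ → C(𝕋, ℂ)))).topologicalClosure := by
    rw [span_fourier_closure_eq_top]
    trivial
  obtain ⟨q, hq, hqd⟩ := Metric.mem_closure_iff.1 hmem r hr0
  refine ⟨q, hq, ?_⟩
  have h1 : ∀ t, ‖g t - q t‖ₑ ≤ ε / 2 := fun t => by
    refine le_trans ?_ hr
    have h2 := (ContinuousMap.dist_apply_le_dist (f := ⟨g, hgc⟩) (g := q) t).trans hqd.le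
    rw [dist_eq_norm] at h2
    rw [enorm_le_coe]
    exact h2
  calc ∫⁻ t, ‖h t - q t‖ₑ ∂μ𝕋 ≤ ∫⁻ t, (‖h t - g t‖ₑ + ε / 2) ∂μ𝕋 := by
        refine lintegral_mono fun t => ?_
        rw [show h t - q t = (h t - g t) + (g t - q t) by ring]
        exact (enorm_add_le _ _).trans (by gcongr; exact h1 t)
    _ ≤ ε / 2 + ε / 2 := by
        rw [lintegral_add_right _ measurable_const]
        simpa using add_le_add_left hg (ε / 2)
    _ = ε := ENNReal.add_halves ε

/-- Functions holomorphic on the disc and continuous up to the boundary are dense in `H¹`. -/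
lemma MemH1.exists_analytic_approx {h : 𝕋 → ℂ} (hh : MemH1 h) {ε : ℝ≥0∞} (hε : ε ≠ 0) :
    ∃ d : ℂ → ℂ, DiffContOnCl ℂ d (Metric.ball 0 1) ∧
      ∫⁻ t, ‖h t - d (circlePt t)‖ₑ ∂μ𝕋 ≤ ε := by
  have hε3 : ε / 3 ≠ 0 := ENNReal.div_ne_zero.2 ⟨hε, by simp⟩
  obtain ⟨q, hq, hhq⟩ := exists_trigPolynomial_approx hh.1 hε3
  obtain ⟨K, hK⟩ := exists_fejerMean_sub_le hq
  have hqi := integrable_of_continuous q.continuous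
  obtain ⟨N, hN⟩ : ∃ N : ℕ, ENNReal.ofReal (K / (N + 1)) ≤ ε / 3 := by
    have h1 : Filter.Tendsto (fun N : ℕ => ENNReal.ofReal (K / ((N : ℝ) + 1))) Filter.atTop
        (nhds 0) := by
      have h2 : Filter.Tendsto (fun N : ℕ => K / ((N : ℝ) + 1)) Filter.atTop (nhds 0) := by
        simpa [div_eq_mul_inv] using (tendsto_one_div_add_atTop_nhds_zero_nat (𝕜 := ℝ)).const_mul K
      simpa using ENNReal.tendsto_ofReal h2
    exact (h1.eventually (Iic_mem_nhds (pos_iff_ne_zero.2 hε3))).exists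
  refine ⟨fun z => ((N : ℂ) + 1)⁻¹ * ∑ j ∈ Finset.range (N + 1), ∑ k ∈ Finset.range (N + 1),
    fourierCoeff h ((j : ℤ) - k) * z ^ ((j : ℤ) - k).toNat, ?_, ?_⟩
  · refine Differentiable.diffContOnCl ?_
    fun_prop
  have hd : ∀ t, ((N : ℂ) + 1)⁻¹ * ∑ j ∈ Finset.range (N + 1), ∑ k ∈ Finset.range (N + 1),
      fourierCoeff h ((j : ℤ) - k) * circlePt t ^ ((j : ℤ) - k).toNat = fejerMean N h t := by
    intro t
    rw [fejerMean]
    congr 1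
    refine Finset.sum_congr rfl fun j _ => Finset.sum_congr rfl fun k _ => ?_
    rcases lt_or_ge ((j : ℤ) - k) 0 with h1 | h1
    · rw [hh.2 _ h1, zero_mul, zero_mul]
    · rw [← fourier_natCast_eq, Int.toNat_of_nonneg h1]
  simp only [hd]
  have hpt : ∀ t, ‖h t - fejerMean N h t‖ₑ ≤
      ‖h t - q t‖ₑ + (ε / 3 + ‖fejerMean N (h - q) t‖ₑ) := by
    intro t
    have h1 : h t - fejerMean N h t =
        (h t - q t) + (-(fejerMean N q t - q t) + -fejerMean N (h - q) t) := by
      rw [fejerMean_sub N hh.1 hqi]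
      ring
    rw [h1]
    refine (enorm_add_le _ _).trans (add_le_add_right ((enorm_add_le _ _).trans ?_) _)
    rw [enorm_neg, enorm_neg]
    gcongr
    rw [← ofReal_norm]
    exact (ENNReal.ofReal_le_ofReal (hK N t)).trans hN
  have hm : AEMeasurable (fun t => ‖h t - q t‖ₑ) μ𝕋 :=
    (hh.1.1.sub hqi.1).enorm
  calc _ ≤ ∫⁻ t, (‖h t - q t‖ₑ + (ε / 3 + ‖fejerMean N (h - q) t‖ₑ)) ∂μ𝕋 := lintegral_mono hpt
    _ = ∫⁻ t, ‖h t - q t‖ₑ ∂μ𝕋 + (ε / 3 + ∫⁻ t, ‖fejerMean N (h - q) t‖ₑ ∂μ𝕋) := by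
        rw [lintegral_add_left' hm, lintegral_add_left' aemeasurable_const]
        simp
    _ ≤ ε / 3 + (ε / 3 + ε / 3) := by
        gcongr
        exact (lintegral_fejerMean_le N (hh.1.sub hqi)).trans hhq
    _ = ε := by rw [← add_assoc, ENNReal.add_thirds]

lemma eLpLqNorm_one_left (q : ℝ) (f : ℕ → 𝕋 → ℂ) :
    eLpLqNorm 1 q f = ∫⁻ t, (∑' k, ‖f k t‖ₑ ^ q) ^ (1 / q) ∂μ𝕋 := by
  simp only [eLpLqNorm, ENNReal.rpow_one, div_one]
  rfl

lemma eLpLqNorm_one_one {f : ℕ → 𝕋 → ℂ} (hf : ∀ k, AEStronglyMeasurable (f k) μ𝕋) :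
    eLpLqNorm 1 1 f = ∑' k, ∫⁻ t, ‖f k t‖ₑ ∂μ𝕋 := by
  rw [eLpLqNorm_one_left, ← lintegral_tsum fun k => (hf k).enorm]
  simp

lemma eLpLqNorm_one_mono {q : ℝ} (hq : 0 ≤ q) {f g : ℕ → 𝕋 → ℂ}
    (h : ∀ k t, ‖f k t‖ₑ ≤ ‖g k t‖ₑ) : eLpLqNorm 1 q f ≤ eLpLqNorm 1 q g := by
  rw [eLpLqNorm_one_left, eLpLqNorm_one_left]
  exact lintegral_mono fun t => ENNReal.rpow_le_rpow
    (ENNReal.tsum_le_tsum fun k => ENNReal.rpow_le_rpow (h k t) hq) (by positivity)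

lemma aemeasurable_tsum_rpow {f : ℕ → 𝕋 → ℂ} (hf : ∀ k, AEStronglyMeasurable (f k) μ𝕋) (q r : ℝ) :
    AEMeasurable (fun t => (∑' k, ‖f k t‖ₑ ^ q) ^ r) μ𝕋 :=
  (AEMeasurable.tsum fun k => (hf k).enorm.pow_const q).pow_const r

lemma tsum_rpow_add_le (a b : ℕ → ℝ≥0∞) {q : ℝ} (hq : 1 ≤ q) :
    (∑' k, (a k + b k) ^ q) ^ (1 / q) ≤
      (∑' k, a k ^ q) ^ (1 / q) + (∑' k, b k ^ q) ^ (1 / q) := by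
  have h := ENNReal.lintegral_Lp_add_le (μ := Measure.count) (f := a) (g := b)
    (measurable_of_countable _).aemeasurable (measurable_of_countable _).aemeasurable hq
  simpa only [lintegral_count, Pi.add_apply] using h

lemma tsum_rpow_le_tsum (a : ℕ → ℝ≥0∞) {q : ℝ} (hq : 1 ≤ q) :
    (∑' k, a k ^ q) ^ (1 / q) ≤ ∑' k, a k := by
  have hq0 : 0 < q := zero_lt_one.trans_le hq
  rw [one_div, ENNReal.rpow_inv_le_iff hq0]
  have h1 : ∀ k, a k ^ q ≤ a k * (∑' k, a k) ^ (q - 1) := fun k => by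
    calc a k ^ q = a k ^ (1 + (q - 1)) := by ring_nf
      _ = a k * a k ^ (q - 1) := by
        rw [ENNReal.rpow_add_of_nonneg _ _ zero_le_one (by linarith), ENNReal.rpow_one]
      _ ≤ _ := by
        exact mul_le_mul_right (ENNReal.rpow_le_rpow (ENNReal.le_tsum k) (by linarith)) _
  calc ∑' k, a k ^ q ≤ ∑' k, a k * (∑' k, a k) ^ (q - 1) := ENNReal.tsum_le_tsum h1
    _ = (∑' k, a k) ^ (1 + (q - 1)) := by
      rw [ENNReal.tsum_mul_right,
        ENNReal.rpow_add_of_nonneg _ _ zero_le_one (by linarith), ENNReal.rpow_one]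
    _ = _ := by ring_nf

lemma eLpLqNorm_one_add_le {f g : ℕ → 𝕋 → ℂ} (hf : ∀ k, AEStronglyMeasurable (f k) μ𝕋)
    {q : ℝ} (hq : 1 ≤ q) :
    eLpLqNorm 1 q (f + g) ≤ eLpLqNorm 1 q f + eLpLqNorm 1 q g := by
  have hq0 : 0 ≤ q := zero_le_one.trans hq
  rw [eLpLqNorm_one_left, eLpLqNorm_one_left, eLpLqNorm_one_left,
    ← lintegral_add_left' (aemeasurable_tsum_rpow hf q (1 / q))]
  refine lintegral_mono fun t => le_trans ?_ (tsum_rpow_add_le _ _ hq)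
  refine ENNReal.rpow_le_rpow (ENNReal.tsum_le_tsum fun k =>
    ENNReal.rpow_le_rpow (enorm_add_le _ _) hq0) (by positivity)

lemma eLpLqNorm_one_le_one_one (f : ℕ → 𝕋 → ℂ) {q : ℝ} (hq : 1 ≤ q) :
    eLpLqNorm 1 q f ≤ eLpLqNorm 1 1 f := by
  rw [eLpLqNorm_one_left, eLpLqNorm_one_left]
  refine lintegral_mono fun t => ?_
  simpa using tsum_rpow_le_tsum (fun k => ‖f k t‖ₑ) hq

/-- Hölder's inequality between the exponents `1` and `2`. -/
lemma tsum_rpow_interpolation (a : ℕ → ℝ≥0∞) {p θ : ℝ} (hp : 0 < p) (h0 : 0 ≤ θ) (h1 : θ ≤ 1)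
    (hθ : 1 / p = θ / 2 + (1 - θ)) :
    (∑' k, a k ^ p) ^ (1 / p) ≤
      ((∑' k, a k ^ (2 : ℝ)) ^ (1 / 2 : ℝ)) ^ θ * ((∑' k, a k ^ (1 : ℝ)) ^ (1 / 1 : ℝ)) ^ (1 - θ)
    := by
  have hα : 0 ≤ p * θ / 2 := by positivity
  have hβ : 0 ≤ p * (1 - θ) := mul_nonneg hp.le (by linarith)
  have hαβ : p * θ / 2 + p * (1 - θ) = 1 := by
    have : p * (1 / p) = 1 := by field_simp
    rw [hθ] at this
    linarith
  have h := ENNReal.lintegral_mul_norm_pow_le (μ := Measure.count) (f := fun k => a k ^ (2 : ℝ))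
    (g := fun k => a k ^ (1 : ℝ)) (measurable_of_countable _).aemeasurable
    (measurable_of_countable _).aemeasurable hα hβ hαβ
  simp only [lintegral_count] at h
  have h2 : ∀ k, (a k ^ (2 : ℝ)) ^ (p * θ / 2) * (a k ^ (1 : ℝ)) ^ (p * (1 - θ)) = a k ^ p :=
    fun k => by
      rw [← ENNReal.rpow_mul, ← ENNReal.rpow_mul,
        ← ENNReal.rpow_add_of_nonneg _ _ (by positivity) (by positivity)]
      ring_nf
  simp only [h2] at h
  refine (ENNReal.rpow_le_rpow h (by positivity : 0 ≤ 1 / p)).trans_eq ?_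
  rw [ENNReal.mul_rpow_of_nonneg _ _ (by positivity), ← ENNReal.rpow_mul, ← ENNReal.rpow_mul,
    ← ENNReal.rpow_mul, ← ENNReal.rpow_mul]
  congr 2
  · field_simp
  · field_simp

lemma eLpLqNorm_one_interpolation {f : ℕ → 𝕋 → ℂ} (hf : ∀ k, AEStronglyMeasurable (f k) μ𝕋)
    {p θ : ℝ} (hp : 0 < p) (h0 : 0 ≤ θ) (h1 : θ ≤ 1) (hθ : 1 / p = θ / 2 + (1 - θ)) :
    eLpLqNorm 1 p f ≤ eLpLqNorm 1 2 f ^ θ * eLpLqNorm 1 1 f ^ (1 - θ) := by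
  rw [eLpLqNorm_one_left, eLpLqNorm_one_left, eLpLqNorm_one_left]
  exact (lintegral_mono fun t => tsum_rpow_interpolation _ hp h0 h1 hθ).trans
    (ENNReal.lintegral_mul_norm_pow_le (aemeasurable_tsum_rpow hf _ _)
      (aemeasurable_tsum_rpow hf _ _) h0 (by linarith) (by ring))

/-- The first `n` terms of a sequence of functions, continued by zero. -/
def truncSeq (n : ℕ) (x : ℕ → 𝕋 → ℂ) : ℕ → 𝕋 → ℂ := fun k t => if k < n then x k t else 0

lemma truncSeq_aestronglyMeasurable (n : ℕ) {x : ℕ → 𝕋 → ℂ}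
    (hx : ∀ k, AEStronglyMeasurable (x k) μ𝕋) (k : ℕ) :
    AEStronglyMeasurable (truncSeq n x k) μ𝕋 := by
  unfold truncSeq
  split_ifs
  · exact hx k
  · exact aestronglyMeasurable_const

lemma eLpLqNorm_truncSeq_le {q : ℝ} (hq : 0 ≤ q) (n : ℕ) (x : ℕ → 𝕋 → ℂ) :
    eLpLqNorm 1 q (truncSeq n x) ≤ eLpLqNorm 1 q x :=
  eLpLqNorm_one_mono hq fun k t => by unfold truncSeq; split_ifs <;> simp

lemma tsum_truncSeq_rpow {q : ℝ} (hq : 0 < q) (n : ℕ) (x : ℕ → 𝕋 → ℂ) (t : 𝕋) :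
    ∑' k, ‖truncSeq n x k t‖ₑ ^ q = ∑ k ∈ Finset.range n, ‖x k t‖ₑ ^ q := by
  rw [tsum_eq_sum (s := Finset.range n)]
  · refine Finset.sum_congr rfl fun k hk => ?_
    rw [truncSeq, if_pos (Finset.mem_range.1 hk)]
  · intro k hk
    rw [truncSeq, if_neg (by simpa using hk), enorm_zero, ENNReal.zero_rpow_of_pos hq]

lemma eLpLqNorm_one_one_truncSeq_le {n : ℕ} {x : ℕ → 𝕋 → ℂ} {δ : ℝ≥0∞}
    (hx : ∀ k, AEStronglyMeasurable (x k) μ𝕋) (h : ∀ k, ∫⁻ t, ‖x k t‖ₑ ∂μ𝕋 ≤ δ) :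
    eLpLqNorm 1 1 (truncSeq n x) ≤ n * δ := by
  rw [eLpLqNorm_one_left]
  simp only [tsum_truncSeq_rpow zero_lt_one]
  simp only [ENNReal.rpow_one, one_div_one]
  rw [lintegral_finsetSum' _ fun k _ => (hx k).enorm]
  simpa using Finset.sum_le_card_nsmul (Finset.range n) _ δ fun k _ => h k

lemma eLpLqNorm_one_one_truncSeq {x : ℕ → 𝕋 → ℂ} (hx : ∀ k, Continuous (x k)) (n : ℕ) :
    eLpLqNorm 1 1 (truncSeq n x) =
      ENNReal.ofReal (∫ t, ∑ k ∈ Finset.range n, ‖x k t‖ ∂μ𝕋) := by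
  rw [eLpLqNorm_one_left, ofReal_integral_eq_lintegral_ofReal
    (integrable_of_continuous (by fun_prop))
    (Filter.Eventually.of_forall fun t => Finset.sum_nonneg fun k _ => norm_nonneg _)]
  refine lintegral_congr fun t => ?_
  rw [tsum_truncSeq_rpow zero_lt_one, ENNReal.ofReal_sum_of_nonneg fun k _ => norm_nonneg _]
  simp

lemma eLpLqNorm_one_two_truncSeq {x : ℕ → 𝕋 → ℂ} (hx : ∀ k, Continuous (x k)) (n : ℕ) :
    eLpLqNorm 1 2 (truncSeq n x) =
      ENNReal.ofReal (∫ t, √(∑ k ∈ Finset.range n, ‖x k t‖ ^ 2) ∂μ𝕋) := by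
  rw [eLpLqNorm_one_left, ofReal_integral_eq_lintegral_ofReal
    (integrable_of_continuous (by fun_prop))
    (Filter.Eventually.of_forall fun t => Real.sqrt_nonneg _)]
  refine lintegral_congr fun t => ?_
  rw [tsum_truncSeq_rpow zero_lt_two, Real.sqrt_eq_rpow,
    ← ENNReal.ofReal_rpow_of_nonneg (Finset.sum_nonneg fun k _ => sq_nonneg _) (by norm_num),
    ENNReal.ofReal_sum_of_nonneg fun k _ => sq_nonneg _]
  congr 1
  refine Finset.sum_congr rfl fun k _ => ?_
  rw [ENNReal.ofReal_pow (norm_nonneg _), ofReal_norm, ENNReal.rpow_two]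

lemma MemH1.sub {f g : 𝕋 → ℂ} (hf : MemH1 f) (hg : MemH1 g) : MemH1 (f - g) := by
  refine ⟨hf.1.sub hg.1, fun n hn => ?_⟩
  rw [fourierCoeff_sub_of_integrable hf.1 hg.1, hf.2 n hn, hg.2 n hn, sub_zero]

lemma memH1_zero : MemH1 0 :=
  ⟨integrable_zero _ _ _, fun n _ => by simp [fourierCoeff]⟩

lemma MemLpLq.integrable {f : ℕ → 𝕋 → ℂ} (hf : MemLpLq 1 1 f) (k : ℕ) : Integrable (f k) μ𝕋 := by
  refine ⟨hf.1 k, ?_⟩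
  have h := hf.2
  rw [eLpLqNorm_one_one hf.1] at h
  exact (ENNReal.le_tsum k).trans_lt h

/-- A representative of `f` modulo `H¹` which is nearly optimal for the `L¹(ℓ₁)` and the
`L¹(ℓ₂)` norms simultaneously. -/
lemma exists_simultaneous_representative {f g h : ℕ → 𝕋 → ℂ} (hf : MemLpLq 1 1 f)
    (hg : ∀ k, MemH1 (g k)) (hh : ∀ k, MemH1 (h k)) {A B : ℝ≥0}
    (hA : eLpLqNorm 1 2 (f - h) < A) (hB : eLpLqNorm 1 1 (f - g) < B) :
    ∃ u : ℕ → 𝕋 → ℂ, (∀ k, MemH1 (u k)) ∧ eLpLqNorm 1 2 (f - u) ≤ 138 * A ∧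
      eLpLqNorm 1 1 (f - u) ≤ 138 * B := by
  obtain ⟨r, hr0, hr⟩ := ENNReal.lt_iff_exists_add_pos_lt.1 hA
  obtain ⟨s, hs0, hs⟩ := ENNReal.lt_iff_exists_add_pos_lt.1 hB
  obtain ⟨η, hη0, hηr, hηs⟩ : ∃ η : ℝ≥0∞, η ≠ 0 ∧ 2 * η ≤ r ∧ 2 * η ≤ s := by
    refine ⟨((min r s / 2 : ℝ≥0) : ℝ≥0∞), ?_, ?_, ?_⟩
    · have : 0 < min r s / 2 := half_pos (lt_min hr0 hs0)
      exact_mod_cast this.ne'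
    · norm_cast
      rw [mul_div_cancel₀ _ two_ne_zero]
      exact min_le_left _ _
    · norm_cast
      rw [mul_div_cancel₀ _ two_ne_zero]
      exact min_le_right _ _
  obtain ⟨n, hn⟩ : ∃ n : ℕ, ∑' k, ∫⁻ t, ‖f (k + n) t‖ₑ ∂μ𝕋 ≤ η := by
    have h1 := hf.2
    rw [eLpLqNorm_one_one hf.1] at h1
    exact ((ENNReal.tendsto_sum_nat_add _ h1.ne).eventually
      (Iic_mem_nhds (pos_iff_ne_zero.2 hη0))).exists
  set δ : ℝ≥0∞ := η / (n + 1) with hδ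
  have hδ0 : δ ≠ 0 := ENNReal.div_ne_zero.2 ⟨hη0, by simp⟩
  have hnδ : n * δ ≤ η := by
    calc n * δ ≤ (n + 1) * δ := by gcongr; simp
      _ ≤ η := ENNReal.mul_div_le
  have hfi := hf.integrable
  choose G hG1 hGη hGc hGi using fun k =>
    ((hfi k).sub (hg k).1).exists_hasCompactSupport_lintegral_sub_le hδ0
  choose d hd hdη using fun k => ((hg k).sub (hh k)).exists_analytic_approx hδ0
  have hdc := fun k => continuous_boundary (hd k)
  set F : ℕ → 𝕋 → ℂ := fun k t => G k t + d k (circlePt t) with hF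
  have hFc : ∀ k, Continuous (F k) := fun k => (hGc k).add (hdc k)
  set P : ℕ → 𝕋 → ℂ := fun k => f k - g k - G k with hP
  set Q : ℕ → 𝕋 → ℂ := fun k t => (g k - h k) t - d k (circlePt t) with hQ
  have hPm : ∀ k, AEStronglyMeasurable (P k) μ𝕋 := fun k =>
    (((hfi k).sub (hg k).1).sub (hGi k)).1
  have hQm : ∀ k, AEStronglyMeasurable (Q k) μ𝕋 := fun k =>
    (((hg k).sub (hh k)).1.sub (integrable_of_continuous (hdc k))).1
  have hPη : eLpLqNorm 1 1 (truncSeq n P) ≤ η :=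
    (eLpLqNorm_one_one_truncSeq_le hPm hGη).trans hnδ
  have hQη : eLpLqNorm 1 1 (truncSeq n Q) ≤ η :=
    (eLpLqNorm_one_one_truncSeq_le hQm hdη).trans hnδ
  have hPn : ∀ k, AEStronglyMeasurable ((-truncSeq n P) k) μ𝕋 := fun k => by
    rw [Pi.neg_apply]
    exact (truncSeq_aestronglyMeasurable n hPm k).neg
  have h12 : (1 : ℝ) ≤ 2 := one_le_two
  have hneg : ∀ (q : ℝ) (x : ℕ → 𝕋 → ℂ), eLpLqNorm 1 q (-x) = eLpLqNorm 1 q x := fun q x => by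
    simp only [eLpLqNorm, Pi.neg_apply, nnnorm_neg]
  have hA' : eLpLqNorm 1 2 (truncSeq n F) < A := by
    have h1 : truncSeq n F = truncSeq n (f - h) + (-truncSeq n P + -truncSeq n Q) := by
      funext k t
      simp only [truncSeq, Pi.add_apply, Pi.neg_apply, Pi.sub_apply, hF, hP, hQ]
      split_ifs <;> ring
    calc eLpLqNorm 1 2 (truncSeq n F)
        ≤ eLpLqNorm 1 2 (truncSeq n (f - h)) +
            (eLpLqNorm 1 2 (-truncSeq n P) + eLpLqNorm 1 2 (-truncSeq n Q)) := by
          rw [h1]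
          refine (eLpLqNorm_one_add_le (truncSeq_aestronglyMeasurable n fun k =>
            ((hfi k).sub (hh k).1).1) h12).trans (add_le_add_right ?_ _)
          exact eLpLqNorm_one_add_le hPn h12
      _ ≤ eLpLqNorm 1 2 (f - h) + (η + η) := by
          rw [hneg, hneg]
          exact add_le_add (eLpLqNorm_truncSeq_le zero_le_two _ _) (add_le_add
            ((eLpLqNorm_one_le_one_one _ h12).trans hPη)
            ((eLpLqNorm_one_le_one_one _ h12).trans hQη))
      _ ≤ eLpLqNorm 1 2 (f - h) + r := by
          rw [← two_mul]
          gcongr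
      _ < A := hr
  have hB' : eLpLqNorm 1 1 (truncSeq n G) < B := by
    have h1 : truncSeq n G = truncSeq n (f - g) + -truncSeq n P := by
      funext k t
      simp only [truncSeq, Pi.add_apply, Pi.neg_apply, Pi.sub_apply, hP]
      split_ifs <;> ring
    calc eLpLqNorm 1 1 (truncSeq n G)
        ≤ eLpLqNorm 1 1 (truncSeq n (f - g)) + eLpLqNorm 1 1 (-truncSeq n P) := by
          rw [h1]
          exact eLpLqNorm_one_add_le (truncSeq_aestronglyMeasurable n fun k =>
            ((hfi k).sub (hg k).1).1) le_rfl
      _ ≤ eLpLqNorm 1 1 (f - g) + 2 * η := by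
          rw [hneg, two_mul]
          gcongr
          · exact eLpLqNorm_truncSeq_le zero_le_one _ _
          · exact hPη.trans le_self_add
      _ ≤ eLpLqNorm 1 1 (f - g) + s := by gcongr
      _ < B := hs
  rw [eLpLqNorm_one_two_truncSeq hFc, ENNReal.ofReal_lt_iff_lt_toReal
    (integral_nonneg fun t => Real.sqrt_nonneg _) ENNReal.coe_ne_top] at hA'
  rw [eLpLqNorm_one_one_truncSeq hGc, ENNReal.ofReal_lt_iff_lt_toReal
    (integral_nonneg fun t => Finset.sum_nonneg fun k _ => norm_nonneg _)
    ENNReal.coe_ne_top] at hB'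
  obtain ⟨e, he, heA, heB⟩ := exists_common_representative n hGc hd (fun k t => rfl) hA' hB'
  have hec := fun k => continuous_boundary (he k)
  set W : ℕ → 𝕋 → ℂ := fun k t => G k t + e k (circlePt t) with hW
  have hWc : ∀ k, Continuous (W k) := fun k => (hGc k).add (hec k)
  have hcoe : ∀ D : ℝ≥0, ENNReal.ofReal (136 * (D : ℝ≥0∞).toReal) = 136 * D := fun D => by
    rw [ENNReal.ofReal_mul (by norm_num), ENNReal.ofReal_toReal ENNReal.coe_ne_top]
    norm_num
  have hWA : eLpLqNorm 1 2 (truncSeq n W) ≤ 136 * A := by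
    rw [eLpLqNorm_one_two_truncSeq hWc, ← hcoe]
    exact ENNReal.ofReal_le_ofReal heA
  have hWB : eLpLqNorm 1 1 (truncSeq n W) ≤ 136 * B := by
    rw [eLpLqNorm_one_one_truncSeq hWc, ← hcoe]
    exact ENNReal.ofReal_le_ofReal heB
  set T : ℕ → 𝕋 → ℂ := fun k t => if k < n then 0 else f k t with hT
  have hTη : eLpLqNorm 1 1 T ≤ η := by
    have hTm : ∀ k, AEStronglyMeasurable (T k) μ𝕋 := fun k => by
      simp only [hT]
      split_ifs
      · exact aestronglyMeasurable_const
      · exact hf.1 k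
    rw [eLpLqNorm_one_one hTm, ← (ENNReal.summable.sum_add_tsum_nat_add' (k := n)),
      Finset.sum_eq_zero, zero_add]
    · simpa [hT] using hn
    · intro k hk
      simp [hT, Finset.mem_range.1 hk]
  refine ⟨fun k t => if k < n then g k t - e k (circlePt t) else 0, fun k => ?_, ?_⟩
  · beta_reduce
    split_ifs
    · exact (hg k).sub (memH1_boundary (he k))
    · exact memH1_zero
  have hfu : (f - fun k t => if k < n then g k t - e k (circlePt t) else 0) =
      truncSeq n W + (truncSeq n P + T) := by
    funext k t
    simp only [truncSeq, Pi.add_apply, Pi.sub_apply, hP, hW, hT]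
    split_ifs <;> ring
  have hle : ∀ {q : ℝ}, 1 ≤ q → eLpLqNorm 1 q (truncSeq n W + (truncSeq n P + T)) ≤
      eLpLqNorm 1 q (truncSeq n W) + 2 * η := fun {q} hq => by
    refine (eLpLqNorm_one_add_le (truncSeq_aestronglyMeasurable n fun k =>
      (hWc k).aestronglyMeasurable) hq).trans ?_
    gcongr
    refine (eLpLqNorm_one_add_le (truncSeq_aestronglyMeasurable n hPm) hq).trans ?_
    rw [two_mul]
    gcongr
    · exact (eLpLqNorm_one_le_one_one _ hq).trans hPη
    · exact (eLpLqNorm_one_le_one_one _ hq).trans hTη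
  have hfin : ∀ D : ℝ≥0, (136 * D + D : ℝ≥0∞) ≤ 138 * D := fun D => by
    calc (136 * D + D : ℝ≥0∞) = 137 * D := by ring
      _ ≤ _ := by gcongr; norm_num
  rw [hfu]
  refine ⟨((hle h12).trans (add_le_add hWA (hηr.trans ?_))).trans (hfin A),
    ((hle le_rfl).trans (add_le_add hWB (hηs.trans ?_))).trans (hfin B)⟩
  · exact le_add_self.trans hr.le
  · exact le_add_self.trans hs.le

lemma quotNormLq_le {q : ℝ} (f : ℕ → 𝕋 → ℂ) {u : ℕ → 𝕋 → ℂ} (hu : ∀ k, MemH1 (u k)) :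
    quotNormLq q f ≤ eLpLqNorm 1 q (f - u) :=
  iInf₂_le u hu

lemma exists_of_quotNormLq_lt {q : ℝ} {f : ℕ → 𝕋 → ℂ} {A : ℝ≥0∞} (h : quotNormLq q f < A) :
    ∃ u : ℕ → 𝕋 → ℂ, (∀ k, MemH1 (u k)) ∧ eLpLqNorm 1 q (f - u) < A := by
  simp only [quotNormLq, iInf_lt_iff] at h
  obtain ⟨u, hu, h⟩ := h
  exact ⟨u, hu, h⟩

lemma quotNormLq_lt_top {q : ℝ} (hq : 1 ≤ q) {f : ℕ → 𝕋 → ℂ} (hf : MemLpLq 1 1 f) :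
    quotNormLq q f < ⊤ := by
  refine (quotNormLq_le f (u := 0) fun _ => memH1_zero).trans_lt ?_
  rw [sub_zero]
  exact (eLpLqNorm_one_le_one_one f hq).trans_lt hf.2

lemma quotNormLq_le_of_lt {f : ℕ → 𝕋 → ℂ} (hf : MemLpLq 1 1 f) {p θ : ℝ} (hp : 0 < p)
    (h0 : 0 ≤ θ) (h1 : θ ≤ 1) (hθ : 1 / p = θ / 2 + (1 - θ)) {A B : ℝ≥0}
    (hA : quotNormLq 2 f < A) (hB : quotNormLq 1 f < B) :
    quotNormLq p f ≤ 138 * (A : ℝ≥0∞) ^ θ * (B : ℝ≥0∞) ^ (1 - θ) := by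
  obtain ⟨h, hh, hA⟩ := exists_of_quotNormLq_lt hA
  obtain ⟨g, hg, hB⟩ := exists_of_quotNormLq_lt hB
  obtain ⟨u, hu, huA, huB⟩ := exists_simultaneous_representative hf hg hh hA hB
  have h1' : 0 ≤ 1 - θ := by linarith
  calc quotNormLq p f ≤ eLpLqNorm 1 p (f - u) := quotNormLq_le f hu
    _ ≤ eLpLqNorm 1 2 (f - u) ^ θ * eLpLqNorm 1 1 (f - u) ^ (1 - θ) :=
      eLpLqNorm_one_interpolation (fun k => (hf.1 k).sub (hu k).1.1) hp h0 h1 hθ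
    _ ≤ (138 * A : ℝ≥0∞) ^ θ * (138 * B : ℝ≥0∞) ^ (1 - θ) := by gcongr
    _ = (138 : ℝ≥0∞) ^ (θ + (1 - θ)) * (A : ℝ≥0∞) ^ θ * (B : ℝ≥0∞) ^ (1 - θ) := by
      rw [ENNReal.mul_rpow_of_nonneg _ _ h0, ENNReal.mul_rpow_of_nonneg _ _ h1',
        ENNReal.rpow_add_of_nonneg _ _ h0 h1']
      ring
    _ = _ := by rw [add_sub_cancel, ENNReal.rpow_one]

/-- **Corollary (4)**: there is an absolute constant `C` such that for `1 < p < 2` and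
`1/p = θ/2 + (1−θ)/1`, every `f ∈ L¹(ℓ₁)` satisfies
`‖f‖_{L¹/H¹(ℓ_p)} ≤ C ‖f‖_{L¹/H¹(ℓ₂)}^θ ‖f‖_{L¹/H¹(ℓ₁)}^{1−θ}`. -/
theorem quotient_norm_interpolation :
    ∃ C : ℝ≥0, 0 < C ∧
      ∀ (p θ : ℝ), 1 < p → p < 2 → 1 / p = θ / 2 + (1 - θ) / 1 →
        ∀ f : ℕ → 𝕋 → ℂ, MemLpLq 1 1 f →
          quotNormLq p f ≤
            C * (quotNormLq 2 f) ^ θ * (quotNormLq 1 f) ^ (1 - θ) := by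
  refine ⟨138, by norm_num, fun p θ hp1 hp2 hθ f hf => ?_⟩
  rw [div_one] at hθ
  have hp0 : 0 < p := by linarith
  have h0 : 0 ≤ θ := by
    have : 1 / p ≤ 1 := by rw [div_le_one hp0]; exact hp1.le
    linarith
  have h1 : θ ≤ 1 := by
    have : 1 / 2 ≤ 1 / p := one_div_le_one_div_of_le hp0 hp2.le
    linarith
  lift quotNormLq 2 f to ℝ≥0 using (quotNormLq_lt_top one_le_two hf).ne with a ha
  lift quotNormLq 1 f to ℝ≥0 using (quotNormLq_lt_top le_rfl hf).ne with b hb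
  have hlim : Filter.Tendsto
      (fun x : ℝ≥0 => 138 * ((a + x : ℝ≥0) : ℝ≥0∞) ^ θ * ((b + x : ℝ≥0) : ℝ≥0∞) ^ (1 - θ))
      (nhdsWithin 0 (Set.Ioi 0)) (nhds (138 * (a : ℝ≥0∞) ^ θ * (b : ℝ≥0∞) ^ (1 - θ))) := by
    have hc : Continuous fun x : ℝ≥0 =>
        138 * (a + x) ^ θ * (b + x) ^ (1 - θ) := by
      have h2 : ∀ (c : ℝ≥0) {z : ℝ}, 0 ≤ z → Continuous fun x : ℝ≥0 => (c + x) ^ z :=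
        fun c z hz => (NNReal.continuous_rpow_const hz).comp (continuous_const.add continuous_id)
      exact (continuous_const.mul (h2 a h0)).mul (h2 b (by linarith))
    have h3 := (ENNReal.continuous_coe.comp hc).tendsto 0
    have h4 : ∀ x : ℝ≥0, (ENNReal.ofNNReal ∘ fun x : ℝ≥0 =>
        138 * (a + x) ^ θ * (b + x) ^ (1 - θ)) x =
        138 * ((a + x : ℝ≥0) : ℝ≥0∞) ^ θ * ((b + x : ℝ≥0) : ℝ≥0∞) ^ (1 - θ) := fun x => by
      rw [Function.comp_apply, ENNReal.coe_mul, ENNReal.coe_mul, ENNReal.coe_rpow_of_nonneg _ h0,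
        ENNReal.coe_rpow_of_nonneg _ (by linarith : 0 ≤ 1 - θ)]
      rfl
    rw [h4] at h3
    simp only [add_zero] at h3
    exact (h3.congr h4).mono_left nhdsWithin_le_nhds
  refine ge_of_tendsto hlim (Filter.eventually_of_mem self_mem_nhdsWithin fun x hx => ?_)
  have hx' : (0 : ℝ≥0) < x := hx
  refine quotNormLq_le_of_lt hf hp0 h0 h1 hθ ?_ ?_
  · rw [← ha]
    exact_mod_cast lt_add_of_pos_right a hx'
  · rw [← hb]
    exact_mod_cast lt_add_of_pos_right b hx'
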